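/- arXiv:1404.6447 — 3 statements merged into one kernel-verified Lean document; each statement's English description precedes it below -/
import Mathlib

section
/- Define L : ℕ → ℝ by L(0) = 1/2 and L(n+1) = (2^n − 1)/2^{n+1} for every natural number n. Then for every integer k ≥ 1, the partial antidiagonal ∑_{n=0}^{k−1} (1 − d_{n+1}(L(n)))·2^{−(n+1)} is equal to L(k); that is, every finite partial result of the diagonal method applied to L is itself an entry of the list L. -/
/-- The `k`-th canonical binary digit of a real `x`: `⌊x·2^k⌋ mod 2`. -/
noncomputable def binDigit (k : ℕ) (x : ℝ) : ℤ := ⌊x * 2 ^ k⌋ % 2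

/-- The list `L(0) = 1/2`, `L(n+1) = (2^n − 1)/2^(n+1)`. -/
noncomputable def L : ℕ → ℝ
  | 0 => 1 / 2
  | n + 1 => (2 ^ n - 1) / 2 ^ (n + 1)

theorem stmt_1 :
    ∀ k : ℕ, 1 ≤ k →
      (∑ n ∈ Finset.range k, (1 - (binDigit (n + 1) (L n) : ℝ)) / 2 ^ (n + 1)) = L k := by
  have h0 : binDigit 1 (L 0) = 1 := by
    have : L 0 * 2 ^ 1 = ((1 : ℤ) : ℝ) := by simp [L]
    unfold binDigit
    rw [this, Int.floor_intCast]
    norm_num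
  have hs : ∀ n : ℕ, binDigit (n + 1 + 1) (L (n + 1)) = 0 := by
    intro n
    have : L (n + 1) * 2 ^ (n + 1 + 1) = ((2 * (2 ^ n - 1) : ℤ) : ℝ) := by
      simp only [L]
      push_cast
      field_simp
      try ring
    unfold binDigit
    rw [this, Int.floor_intCast]
    simp
  intro k hk
  induction k, hk using Nat.le_induction with
  | base =>
    rw [Finset.sum_range_one, h0]
    simp [L]
  | succ k hk ih =>
    rw [Finset.sum_range_succ, ih]
    obtain ⟨m, rfl⟩ : ∃ m, k = m + 1 := ⟨k - 1, by omega⟩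
    rw [hs]
    simp only [L]
    push_cast
    field_simp
    ring
end

section
/- The digit-reversal map DI : ℕ → ℚ is injective, and its range is exactly the set of dyadic rationals in [0,1), i.e. range(DI) = {q : ℚ | ∃ m k : ℕ, k < 2^m ∧ q = k/2^m}. Consequently DI is a bijection between the natural numbers and the set of dyadic rationals in [0,1). -/
/-- The digit-reversal map: `DI(n) = ∑_i bit_i(n)·2^{-(i+1)}`, where
`bit_i(n) = ⌊n/2^i⌋ mod 2` (all bits with index `i ≥ n` vanish). -/
def DI (n : ℕ) : ℚ := ∑ i ∈ Finset.range n, ((n / 2 ^ i % 2 : ℕ) : ℚ) / 2 ^ (i + 1)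

theorem DI_ext (n N : ℕ) (h : n ≤ N) :
    DI n = ∑ i ∈ Finset.range N, ((n / 2 ^ i % 2 : ℕ) : ℚ) / 2 ^ (i + 1) := by
  unfold DI
  apply Finset.sum_subset (Finset.range_mono h)
  intro i _ hi
  have h1 : n ≤ i := by simpa using hi
  have h2 : n < 2 ^ i := lt_of_le_of_lt h1 Nat.lt_two_pow_self
  simp [Nat.div_eq_of_lt h2]

theorem DI_rec (n : ℕ) : DI n = (((n % 2 : ℕ) : ℚ) + DI (n / 2)) / 2 := by
  rw [DI_ext n (n + 1) (by omega), DI_ext (n / 2) n (by omega), Finset.sum_range_succ',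
    add_div, Finset.sum_div, add_comm]
  congr 1
  · simp
  · apply Finset.sum_congr rfl
    intro i _
    rw [Nat.div_div_eq_div_mul, ← pow_succ', pow_succ (2 : ℚ) (i + 1), div_mul_eq_div_div]

theorem DI_zero : DI 0 = 0 := by simp [DI]

theorem DI_bd (N : ℕ) : ∀ n ≤ N, 0 ≤ DI n ∧ DI n < 1 := by
  induction N with
  | zero =>
    intro n hn
    obtain rfl : n = 0 := by omega
    simp [DI_zero]
  | succ N ih =>
    intro n hn
    obtain ⟨h1, h2⟩ := ih (n / 2) (by omega)
    rw [DI_rec n]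
    rcases Nat.mod_two_eq_zero_or_one n with h | h <;> rw [h] <;> push_cast <;>
      constructor <;> linarith

theorem DI_inj (N : ℕ) : ∀ n ≤ N, ∀ m ≤ N, DI n = DI m → n = m := by
  induction N with
  | zero => intros; omega
  | succ N ih =>
    intro n hn m hm h
    have ih' := ih (n / 2) (by omega) (m / 2) (by omega)
    obtain ⟨h1, h2⟩ := DI_bd _ (n / 2) le_rfl
    obtain ⟨h3, h4⟩ := DI_bd _ (m / 2) le_rfl
    rw [DI_rec n, DI_rec m] at h
    rcases Nat.mod_two_eq_zero_or_one n with a | a <;>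
    rcases Nat.mod_two_eq_zero_or_one m with b | b <;> rw [a, b] at h <;> push_cast at h
    · have := ih' (by linarith)
      omega
    · exfalso; linarith
    · exfalso; linarith
    · have := ih' (by linarith)
      omega

theorem DI_dyadic (N : ℕ) : ∀ n ≤ N, ∃ m k : ℕ, k < 2 ^ m ∧ DI n = (k : ℚ) / 2 ^ m := by
  induction N with
  | zero =>
    intro n hn
    obtain rfl : n = 0 := by omega
    exact ⟨0, 0, by simp, by simp [DI_zero]⟩
  | succ N ih =>
    intro n hn
    obtain ⟨m, k, hk, h⟩ := ih (n / 2) (by omega)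
    refine ⟨m + 1, n % 2 * 2 ^ m + k, ?_, ?_⟩
    · rcases Nat.mod_two_eq_zero_or_one n with a | a <;> rw [a, pow_succ] <;> omega
    · rw [DI_rec n, h, pow_succ]
      push_cast
      field_simp

theorem DI_surj (m : ℕ) : ∀ k : ℕ, k < 2 ^ m → ∃ n, DI n = (k : ℚ) / 2 ^ m := by
  induction m with
  | zero =>
    intro k hk
    obtain rfl : k = 0 := by simpa using hk
    exact ⟨0, by simp [DI_zero]⟩
  | succ m ih =>
    intro k hk
    rw [pow_succ] at hk
    by_cases hlt : k < 2 ^ m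
    · obtain ⟨n, hn⟩ := ih k hlt
      refine ⟨2 * n, ?_⟩
      rw [DI_rec, show 2 * n % 2 = 0 by omega, show 2 * n / 2 = n by omega, hn, pow_succ]
      push_cast
      field_simp
      try ring
    · obtain ⟨j, rfl⟩ := Nat.exists_eq_add_of_le (not_lt.mp hlt)
      obtain ⟨n, hn⟩ := ih j (by omega)
      refine ⟨2 * n + 1, ?_⟩
      rw [DI_rec, show (2 * n + 1) % 2 = 1 by omega, show (2 * n + 1) / 2 = n by omega, hn,
        pow_succ]
      push_cast
      field_simp

theorem stmt_2 :
    Function.Injective DI ∧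
    Set.range DI = {q : ℚ | ∃ m k : ℕ, k < 2 ^ m ∧ q = (k : ℚ) / 2 ^ m} := by
  refine ⟨fun n m h => DI_inj (max n m) n (le_max_left _ _) m (le_max_right _ _) h, ?_⟩
  ext q
  constructor
  · rintro ⟨n, rfl⟩
    exact DI_dyadic n n le_rfl
  · rintro ⟨m, k, hk, rfl⟩
    exact DI_surj m k hk
end

section
/- For all natural numbers a, k and every natural number m < 2^k, there exists exactly one natural number n with a ≤ n < a + 2^k such that DI(m) ≤ DI(n) < DI(m) + 2^{−k}; that is, every block of 2^k consecutive positions of the list (DI(n))_{n∈ℕ} contains exactly one entry whose first k binary digits coincide with those of DI(m). -/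
theorem DI_nonneg (n : ℕ) : 0 ≤ DI n := by
  unfold DI
  positivity

theorem DI_le (k : ℕ) : ∀ m : ℕ, m < 2 ^ k → DI m + 1 / 2 ^ k ≤ 1 := by
  induction k with
  | zero =>
    intro m hm
    have : m = 0 := by simpa using hm
    subst this
    simp [DI_zero]
  | succ k ih =>
    intro m hm
    have h := ih (m / 2) (by rw [pow_succ] at hm; omega)
    rw [DI_rec m]
    have h2 : ((m % 2 : ℕ) : ℚ) ≤ 1 := by
      have : m % 2 ≤ 1 := by omega
      exact_mod_cast this
    have h3 : (1 : ℚ) / 2 ^ (k + 1) = (1 / 2 ^ k) / 2 := by rw [pow_succ, div_div]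
    rw [h3]
    linarith

theorem DI_lt_one (n : ℕ) : DI n < 1 := by
  have h := DI_le n n Nat.lt_two_pow_self
  have : (0 : ℚ) < 1 / 2 ^ n := by positivity
  linarith

theorem DI_key (k : ℕ) : ∀ m n : ℕ, m < 2 ^ k →
    ((DI m ≤ DI n ∧ DI n < DI m + 1 / 2 ^ k) ↔ n % 2 ^ k = m) := by
  induction k with
  | zero =>
    intro m n hm
    have : m = 0 := by simpa using hm
    subst this
    simp [DI_zero, DI_nonneg, DI_lt_one, Nat.mod_one]
  | succ k ih =>
    intro m n hm
    have hm' : m / 2 < 2 ^ k := by rw [pow_succ] at hm; omega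
    have h := ih (m / 2) (n / 2) hm'
    have h3 : (1 : ℚ) / 2 ^ (k + 1) = (1 / 2 ^ k) / 2 := by rw [pow_succ, div_div]
    have h4 : n % 2 ^ (k + 1) = n % 2 + 2 * (n / 2 % 2 ^ k) := by
      rw [pow_succ', Nat.mod_mul]
    have hl := DI_le k _ hm'
    have a1 := DI_nonneg (n / 2)
    have a2 := DI_nonneg (m / 2)
    have a3 := DI_lt_one (n / 2)
    rw [DI_rec m, DI_rec n, h3, h4]
    rcases Nat.mod_two_eq_zero_or_one m with hb | hb <;>
    rcases Nat.mod_two_eq_zero_or_one n with hc | hc <;> rw [hb, hc]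
    · have e : (0 + 2 * (n / 2 % 2 ^ k) = m) ↔ n / 2 % 2 ^ k = m / 2 := by omega
      rw [e, ← h]
      constructor <;> rintro ⟨x, y⟩ <;> constructor <;> push_cast at * <;> linarith
    · constructor
      · rintro ⟨x, y⟩
        exfalso
        push_cast at *
        linarith
      · intro x
        omega
    · constructor
      · rintro ⟨x, y⟩
        exfalso
        push_cast at *
        linarith
      · intro x
        omega
    · have e : (1 + 2 * (n / 2 % 2 ^ k) = m) ↔ n / 2 % 2 ^ k = m / 2 := by omega
      rw [e, ← h]
      constructor <;> rintro ⟨x, y⟩ <;> constructor <;> push_cast at * <;> linarith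

theorem block_unique (a K m : ℕ) (hm : m < K) :
    ∃! n : ℕ, (a ≤ n ∧ n < a + K) ∧ n % K = m := by
  have hd := Nat.div_add_mod a K
  have hr := Nat.mod_lt a (show K > 0 by omega)
  apply existsUnique_of_exists_of_unique
  · by_cases hc : a % K ≤ m
    · refine ⟨K * (a / K) + m, ⟨by omega, by omega⟩, ?_⟩
      rw [Nat.mul_add_mod, Nat.mod_eq_of_lt hm]
    · refine ⟨K * (a / K + 1) + m, ?_, ?_⟩
      · rw [mul_add]
        constructor <;> omega
      · rw [Nat.mul_add_mod, Nat.mod_eq_of_lt hm]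
  · rintro x y ⟨⟨x1, x2⟩, x3⟩ ⟨⟨y1, y2⟩, y3⟩
    have hxy : x ≡ y [MOD K] := x3.trans y3.symm
    apply Nat.ModEq.eq_of_abs_lt hxy
    rw [abs_lt]
    constructor <;> omega

theorem stmt_4 :
    ∀ a k m : ℕ, m < 2 ^ k →
      ∃! n : ℕ, (a ≤ n ∧ n < a + 2 ^ k) ∧ DI m ≤ DI n ∧ DI n < DI m + 1 / 2 ^ k := by
  intro a k m hm
  simp only [DI_key k m _ hm]
  exact block_unique a (2 ^ k) m hm
end
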